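/- arXiv:2112.03965 — 9 statements merged into one kernel-verified Lean document; each statement's English description precedes it below -/
import Mathlib

section
/- For every n ≥ 1 and every integer-feasible pair (x, y) for the lot-sizing instance, the objective value satisfies Obj(x, y) ≥ n(n+1)/2 + n. -/
open Finset

/-- LP-feasibility for the lot-sizing instance on `n` periods with
`p_j = n - j + 1`, `f_j = 1`, `d_j = 1`.  Index `j : Fin n` represents
period `(j : ℕ) + 1 ∈ {1, …, n}`. -/
def LPFeasible (n : ℕ) (x y : Fin n → ℝ) : Prop :=
  (∀ i : Fin n, (i : ℕ) + 1 ≤ n - 1 →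
      (((i : ℕ) + 1 : ℝ)) ≤ ∑ k ∈ Finset.Iic i, x k) ∧
  (∑ k, x k = (n : ℝ)) ∧
  (∀ j : Fin n, 0 ≤ x j ∧ x j ≤ ((n : ℝ) - ((j : ℕ) + 1) + 1) * y j) ∧
  (∀ j : Fin n, 0 ≤ y j ∧ y j ≤ 1)

/-- Objective `∑ p_j x_j + ∑ f_j y_j` with `p_j = n - j + 1`, `f_j = 1`. -/
def Obj (n : ℕ) (x y : Fin n → ℝ) : ℝ :=
  (∑ j : Fin n, ((n : ℝ) - ((j : ℕ) + 1) + 1) * x j) + ∑ j : Fin n, y j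

/-- Integer feasibility: LP-feasible with binary `y`. -/
def IntFeasible (n : ℕ) (x y : Fin n → ℝ) : Prop :=
  LPFeasible n x y ∧ ∀ j, y j = 0 ∨ y j = 1

/-- Weighting the terms of a sequence by `n - j` amounts to summing its partial sums. -/
lemma sum_range_sub_mul_eq_sum_partialSum (g : ℕ → ℝ) (n : ℕ) :
    ∑ j ∈ range n, ((n : ℝ) - j) * g j
      = ∑ m ∈ range n, ∑ k ∈ range m, g k + ∑ k ∈ range n, g k := by
  induction n with
  | zero => simp
  | succ n ih =>
    have h : ∑ j ∈ range n, (((n + 1 : ℕ) : ℝ) - j) * g j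
        = ∑ j ∈ range n, ((n : ℝ) - j) * g j + ∑ j ∈ range n, g j := by
      rw [← sum_add_distrib]
      refine sum_congr rfl fun j _ => ?_
      push_cast
      ring
    rw [sum_range_succ, h, ih, sum_range_succ (fun m => ∑ k ∈ range m, g k),
      sum_range_succ g]
    push_cast
    ring

/-- The sum of the first `n` natural numbers, as a real number. -/
lemma sum_range_natCast (n : ℕ) : ∑ m ∈ range n, (m : ℝ) = n * (n - 1) / 2 := by
  induction n with
  | zero => simp
  | succ n ih =>
    rw [sum_range_succ, ih]
    push_cast
    ring

/-- Partial sums over `Fin n` as sums over an initial segment of `ℕ`. -/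
lemma Fin.sum_Iic_eq_sum_range {n : ℕ} (g : ℕ → ℝ) (i : Fin n) :
    ∑ k ∈ Finset.Iic i, g k = ∑ k ∈ range ((i : ℕ) + 1), g k := by
  rw [Nat.range_succ_eq_Iic, ← Fin.map_valEmbedding_Iic, sum_map]
  rfl

/-- every integer-feasible pair has objective at least `n(n+1)/2 + n`. -/
theorem intFeasible_obj_lower_bound (n : ℕ) (hn : 1 ≤ n) (x y : Fin n → ℝ)
    (hxy : IntFeasible n x y) :
    Obj n x y ≥ (n : ℝ) * (n + 1) / 2 + n := by
  obtain ⟨⟨hpre, htot, hx, -⟩, hint⟩ := hxy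
  obtain ⟨g, hg⟩ : ∃ g : ℕ → ℝ, ∀ k : Fin n, x k = g k :=
    ⟨fun k => if h : k < n then x ⟨k, h⟩ else 0, fun k => by simp⟩
  obtain ⟨z, hz⟩ : ∃ z : ℕ → ℝ, ∀ k : Fin n, y k = z k :=
    ⟨fun k => if h : k < n then y ⟨k, h⟩ else 0, fun k => by simp⟩
  simp only [hg, hz] at hpre htot hx hint
  rw [Fin.sum_univ_eq_sum_range g] at htot
  have hobj : Obj n x y = ∑ j ∈ range n, ((n : ℝ) - j) * g j + ∑ j ∈ range n, z j := by
    rw [← Fin.sum_univ_eq_sum_range, ← Fin.sum_univ_eq_sum_range, Obj]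
    simp only [hg, hz]
    congr 1
    refine sum_congr rfl fun j _ => ?_
    ring
  have hS : ∀ m < n, ((m : ℝ) + 1) ≤ ∑ k ∈ range (m + 1), g k := by
    intro m hm
    by_cases h : m + 1 ≤ n - 1
    · have := hpre ⟨m, hm⟩ h
      rwa [Fin.sum_Iic_eq_sum_range] at this
    · obtain rfl : n = m + 1 := by omega
      rw [htot]
      push_cast
      exact le_rfl
  have hS' : ∀ m < n, (m : ℝ) ≤ ∑ k ∈ range m, g k := by
    intro m hm
    cases m with
    | zero => simp
    | succ m => exact_mod_cast hS m (by omega)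
  have key : ∑ m ∈ range n, ((m : ℝ) + 1) ≤ ∑ m ∈ range n, (∑ k ∈ range m, g k + z m) := by
    refine sum_le_sum fun m hm => ?_
    have hm := mem_range.mp hm
    rcases hint ⟨m, hm⟩ with h | h <;> simp only at h
    · have h1 := hx ⟨m, hm⟩
      simp only [h, mul_zero] at h1
      have h2 := hS m hm
      rw [sum_range_succ] at h2
      linarith [h1.2]
    · linarith [hS' m hm]
  rw [sum_add_distrib, sum_add_distrib, sum_range_natCast] at key
  simp only [sum_const, card_range, nsmul_eq_mul, mul_one] at key
  rw [hobj, sum_range_sub_mul_eq_sum_partialSum, htot]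
  linarith
end

section
/- For every n ≥ 1, the value n(n+1)/2 + n is the minimum of Obj over all integer-feasible pairs for the lot-sizing instance; that is, it is a lower bound on Obj over integer-feasible pairs and it is attained by some integer-feasible pair. -/
open Finset

/-- Summing prefix sums weights the `k`-th term by the number `n - k` of prefixes containing it. -/
lemma sum_sum_Iic_eq (n : ℕ) (x : Fin n → ℝ) :
    ∑ j : Fin n, ∑ k ∈ Finset.Iic j, x k = ∑ k : Fin n, ((n : ℝ) - (k : ℕ)) * x k := by
  have h : ∑ j : Fin n, ∑ k ∈ Finset.Iic j, x k = ∑ k : Fin n, ∑ _j ∈ Finset.Ici k, x k :=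
    Finset.sum_comm' (by simp)
  rw [h]
  refine Finset.sum_congr rfl fun k _ => ?_
  rw [Finset.sum_const, Fin.card_Ici, nsmul_eq_mul, Nat.cast_sub k.isLt.le]

lemma sum_fin_add_one (n : ℕ) :
    ∑ j : Fin n, (((j : ℕ) : ℝ) + 1) = (n : ℝ) * (n + 1) / 2 := by
  rw [Fin.sum_univ_eq_sum_range (fun j => ((j : ℕ) : ℝ) + 1) n]
  induction n with
  | zero => simp
  | succ m ih =>
    rw [Finset.sum_range_succ, ih]
    push_cast
    ring

lemma obj_eq_sum_prefix (n : ℕ) (x y : Fin n → ℝ) :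
    Obj n x y = ∑ j : Fin n, ∑ k ∈ Finset.Iic j, x k + ∑ j, y j := by
  rw [sum_sum_Iic_eq, Obj]
  congr 1
  exact Finset.sum_congr rfl fun j _ => by ring

/-- In an LP-feasible plan, cumulative production covers cumulative demand in every period,
including the last one. -/
lemma LPFeasible.le_sum_Iic {n : ℕ} {x y : Fin n → ℝ} (h : LPFeasible n x y) (j : Fin n) :
    ((j : ℕ) : ℝ) + 1 ≤ ∑ k ∈ Finset.Iic j, x k := by
  obtain ⟨hpre, htot, -, -⟩ := h
  by_cases hj : (j : ℕ) + 1 ≤ n - 1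
  · exact hpre j hj
  · have hn : (j : ℕ) + 1 = n := by omega
    have huniv : Finset.Iic j = Finset.univ := by
      ext k
      simp only [Finset.mem_Iic, Finset.mem_univ, iff_true, Fin.le_def]
      omega
    rw [huniv, htot]
    exact_mod_cast hn.le

/-- The stock available before period `j` covers the demand of earlier periods. -/
lemma LPFeasible.le_sum_Iio {n : ℕ} {x y : Fin n → ℝ} (h : LPFeasible n x y) (j : Fin n) :
    ((j : ℕ) : ℝ) ≤ ∑ k ∈ Finset.Iio j, x k := by
  rcases Nat.eq_zero_or_pos (j : ℕ) with hj | hj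
  · rw [hj, Nat.cast_zero]
    exact Finset.sum_nonneg fun k _ => (h.2.2.1 k).1
  · let i : Fin n := ⟨j - 1, by omega⟩
    have hIic : Finset.Iio j = Finset.Iic i := by
      ext k
      simp only [Finset.mem_Iio, Finset.mem_Iic, Fin.le_def, Fin.lt_def, i]
      omega
    have hi : ((i : ℕ) : ℝ) + 1 = (j : ℕ) := by
      exact_mod_cast Nat.sub_add_cancel hj
    rw [hIic, ← hi]
    exact h.le_sum_Iic i

/-- Either a setup is paid in period `j`, or its demand is met from stock. -/
lemma IntFeasible.add_one_le {n : ℕ} {x y : Fin n → ℝ} (h : IntFeasible n x y) (j : Fin n) :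
    ((j : ℕ) : ℝ) + 1 ≤ ∑ k ∈ Finset.Iic j, x k - x j + y j := by
  obtain ⟨hlp, hy⟩ := h
  rcases hy j with h0 | h1
  · have hx := (hlp.2.2.1 j).2
    rw [h0, mul_zero] at hx
    linarith [hlp.le_sum_Iic j]
  · have hsplit : ∑ k ∈ Finset.Iic j, x k = x j + ∑ k ∈ Finset.Iio j, x k := by
      rw [← Finset.Iio_insert, Finset.sum_insert (by simp)]
    linarith [hlp.le_sum_Iio j]

lemma intFeasible_one (n : ℕ) : IntFeasible n (fun _ => 1) (fun _ => 1) := by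
  refine ⟨⟨fun i _ => ?_, by simp, fun j => ⟨zero_le_one, ?_⟩, fun _ => ⟨zero_le_one, le_rfl⟩⟩,
    fun _ => Or.inr rfl⟩
  · simp [Fin.card_Iic]
  · have hj : ((j : ℕ) : ℝ) + 1 ≤ n := by exact_mod_cast j.isLt
    linarith

/-- `n(n+1)/2 + n` is the minimum of the objective over
integer-feasible pairs. -/
theorem opt_value_isLeast (n : ℕ) (hn : 1 ≤ n) :
    IsLeast {v : ℝ | ∃ x y : Fin n → ℝ, IntFeasible n x y ∧ Obj n x y = v}
      ((n : ℝ) * (n + 1) / 2 + n) := by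
  constructor
  · refine ⟨fun _ => 1, fun _ => 1, intFeasible_one n, ?_⟩
    rw [obj_eq_sum_prefix, ← sum_fin_add_one]
    simp [Fin.card_Iic]
  · rintro _ ⟨x, y, h, rfl⟩
    have hsum := Finset.sum_le_sum fun j (_ : j ∈ Finset.univ) => h.add_one_le j
    rw [sum_fin_add_one, Finset.sum_add_distrib, Finset.sum_sub_distrib, h.1.2.1] at hsum
    rw [obj_eq_sum_prefix]
    linarith
end

section
/- Let n ≥ 3 be odd, let u, v ∈ S with u ≠ v, and set ŷ = (u + v)/2. Define x̂ ∈ ℝ^n by: x̂_n = 1; for odd j < n, x̂_j = 2 if ŷ_{j+1} = 0 and x̂_j = 1 if ŷ_{j+1} ∈ {1/2, 1}; for even j, x̂_j = 0 if ŷ_j = 0 and x̂_j = 1 if ŷ_j ∈ {1/2, 1}. Then the pair (x̂, ŷ) is LP-feasible for the lot-sizing instance. -/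
open Finset

/-- For odd `n`: the set of 0/1 vectors whose coordinates at odd periods equal 1. -/
def Sodd (n : ℕ) : Set (Fin n → ℝ) :=
  {y | (∀ j, y j = 0 ∨ y j = 1) ∧ ∀ j : Fin n, Odd ((j : ℕ) + 1) → y j = 1}

/-- The specification of `x̂` built from `ŷ` in the paper's proof:
`x̂_n = 1`; for odd periods `j < n`, `x̂_j = 2` if `ŷ_{j+1} = 0` and `x̂_j = 1`
if `ŷ_{j+1} ∈ {1/2, 1}`; for even periods `j`, `x̂_j = 0` if `ŷ_j = 0` and
`x̂_j = 1` if `ŷ_j ∈ {1/2, 1}`. -/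
def XhatSpec (n : ℕ) (yhat xhat : Fin n → ℝ) : Prop :=
  (∀ j : Fin n, (j : ℕ) + 1 = n → xhat j = 1) ∧
  (∀ j : Fin n, ∀ hj : (j : ℕ) + 1 < n, Odd ((j : ℕ) + 1) →
      ((yhat ⟨(j : ℕ) + 1, hj⟩ = 0 → xhat j = 2) ∧
       (yhat ⟨(j : ℕ) + 1, hj⟩ = 1/2 ∨ yhat ⟨(j : ℕ) + 1, hj⟩ = 1 → xhat j = 1))) ∧
  (∀ j : Fin n, Even ((j : ℕ) + 1) →
      ((yhat j = 0 → xhat j = 0) ∧ (yhat j = 1/2 ∨ yhat j = 1 → xhat j = 1)))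

theorem sum_range_two_mul_of_pair_sum_eq_two {X : ℕ → ℝ} {N : ℕ}
    (h : ∀ m, m < N → X (2 * m) + X (2 * m + 1) = 2) :
    ∀ m, m ≤ N → ∑ k ∈ Finset.range (2 * m), X k = 2 * m := by
  intro m
  induction m with
  | zero => simp
  | succ m ih =>
    intro hm
    rw [Nat.mul_succ, Finset.sum_range_succ, Finset.sum_range_succ, ih (by omega)]
    have := h m (by omega)
    push_cast
    linarith

theorem sum_Iic_fin_eq_sum_range {n : ℕ} (X : ℕ → ℝ) (i : Fin n) :
    ∑ k ∈ Finset.Iic i, X k = ∑ k ∈ Finset.range (i + 1), X k := by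
  rw [Nat.range_succ_eq_Iic, ← Fin.map_valEmbedding_Iic, Finset.sum_map]
  rfl

theorem midpoint_mem_of_zero_or_one {a b : ℝ} (ha : a = 0 ∨ a = 1) (hb : b = 0 ∨ b = 1) :
    (a + b) / 2 = 0 ∨ (a + b) / 2 = 1 / 2 ∨ (a + b) / 2 = 1 := by
  rcases ha with rfl | rfl <;> rcases hb with rfl | rfl <;> norm_num

/-- Half-integral `y` equal to `1` at odd periods, together with the `x` that `XhatSpec`
assigns to it, is LP-feasible. -/
theorem XhatSpec.lpFeasible {n : ℕ} (hodd : Odd n) {y x : Fin n → ℝ}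
    (hy : ∀ j, y j = 0 ∨ y j = 1 / 2 ∨ y j = 1)
    (hy1 : ∀ j : Fin n, Odd ((j : ℕ) + 1) → y j = 1) (hx : XhatSpec n y x) :
    LPFeasible n x y := by
  obtain ⟨hlast, hxodd, hxeven⟩ := hx
  obtain ⟨N, rfl⟩ := hodd
  have hpair : ∀ m (hm : m < N), 1 ≤ x ⟨2 * m, by omega⟩ ∧ x ⟨2 * m, by omega⟩ ≤ 2 ∧
      x ⟨2 * m, by omega⟩ + x ⟨2 * m + 1, by omega⟩ = 2 := by
    intro m hm
    have ho := hxodd ⟨2 * m, by omega⟩ (by simp; omega) ⟨m, rfl⟩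
    have he := hxeven ⟨2 * m + 1, by omega⟩ ⟨m + 1, by simp; omega⟩
    rcases hy ⟨2 * m + 1, by omega⟩ with h | h
    · rw [ho.1 h, he.1 h]; norm_num
    · rw [ho.2 h, he.2 h]; norm_num
  have hxN : x ⟨2 * N, by omega⟩ = 1 := hlast _ rfl
  let X : ℕ → ℝ := fun k => if h : k < 2 * N + 1 then x ⟨k, h⟩ else 0
  have hXlt : ∀ k (h : k < 2 * N + 1), X k = x ⟨k, h⟩ := fun k h => dif_pos h
  have hXval : ∀ k : Fin (2 * N + 1), x k = X k := fun k => (hXlt k k.isLt).symm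
  have hsum := sum_range_two_mul_of_pair_sum_eq_two (X := X) (N := N) (fun m hm => by
    rw [hXlt _ (by omega), hXlt _ (by omega)]
    exact (hpair m hm).2.2)
  refine ⟨?_, ?_, ?_, ?_⟩
  · rintro ⟨i, hi⟩ hin
    simp only [hXval]
    rw [sum_Iic_fin_eq_sum_range]
    simp only at hin ⊢
    rcases Nat.even_or_odd' i with ⟨m, rfl | rfl⟩
    · rw [Finset.sum_range_succ, hsum m (by omega), hXlt _ hi]
      have := (hpair m (by omega)).1
      push_cast
      linarith
    · have h := hsum (m + 1) (by omega)
      rw [Nat.mul_succ] at h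
      rw [h]
      push_cast
      linarith
  · simp only [hXval]
    rw [Fin.sum_univ_eq_sum_range, Finset.sum_range_succ, hsum N le_rfl, hXlt _ (by omega), hxN]
    push_cast
    ring
  · rintro ⟨j, hj⟩
    rcases Nat.even_or_odd' j with ⟨m, rfl | rfl⟩
    · rw [hy1 ⟨2 * m, hj⟩ ⟨m, rfl⟩]
      rcases (show m ≤ N by omega).eq_or_lt with rfl | hm
      · rw [hxN]
        push_cast
        constructor <;> linarith
      · obtain ⟨h1, h2, -⟩ := hpair m hm
        have : (m : ℝ) + 1 ≤ N := by exact_mod_cast hm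
        push_cast
        constructor <;> linarith
    · have he := hxeven ⟨2 * m + 1, hj⟩ ⟨m + 1, by simp; omega⟩
      have : (m : ℝ) + 1 ≤ N := by exact_mod_cast (show m + 1 ≤ N by omega)
      rcases hy ⟨2 * m + 1, hj⟩ with h | h
      · rw [he.1 h, h]; simp
      · rw [he.2 h]
        push_cast
        rcases h with h | h <;> rw [h] <;> constructor <;> linarith
  · intro j
    rcases hy j with h | h | h <;> rw [h] <;> norm_num

/-- for odd `n ≥ 3`, distinct `u, v ∈ S`, `ŷ = (u+v)/2` and `x̂`
as in the paper's construction, the pair `(x̂, ŷ)` is LP-feasible. -/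
theorem xhat_yhat_LPFeasible (n : ℕ) (hn : 3 ≤ n) (hodd : Odd n)
    (u v : Fin n → ℝ) (hu : u ∈ Sodd n) (hv : v ∈ Sodd n) (huv : u ≠ v)
    (xhat : Fin n → ℝ) (hx : XhatSpec n (fun j => (u j + v j) / 2) xhat) :
    LPFeasible n xhat (fun j => (u j + v j) / 2) := by
  exact hx.lpFeasible hodd (fun j => midpoint_mem_of_zero_or_one (hu.1 j) (hv.1 j)) fun j hj => by
    rw [hu.2 j hj, hv.2 j hj]
    norm_num
end

section
/- Let n ≥ 3 be odd, let u, v ∈ S with u ≠ v, and set ŷ = (u + v)/2. Define x̂ ∈ ℝ^n by: x̂_n = 1; for odd j < n, x̂_j = 2 if ŷ_{j+1} = 0 and x̂_j = 1 if ŷ_{j+1} ∈ {1/2, 1}; for even j, x̂_j = 0 if ŷ_j = 0 and x̂_j = 1 if ŷ_j ∈ {1/2, 1}. Then Obj(x̂, ŷ) = n(n+1)/2 + n − (1/2)·N, where N is the number of indices j ∈ {1,...,n} with ŷ_j = 1/2. -/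
open Finset

/-- A sum over an odd number of indices vanishes when consecutive pairs cancel and the last
term is zero. -/
theorem sum_range_eq_zero_of_pairs {m : ℕ} {g : ℕ → ℝ}
    (hpair : ∀ k < m, g (2 * k) + g (2 * k + 1) = 0) (hlast : g (2 * m) = 0) :
    ∑ j ∈ Finset.range (2 * m + 1), g j = 0 := by
  rw [Finset.sum_range_succ, hlast, add_zero]
  clear hlast
  induction m with
  | zero => simp
  | succ m ih =>
    rw [show 2 * (m + 1) = 2 * m + 1 + 1 by ring, Finset.sum_range_succ, Finset.sum_range_succ,
      ih fun k hk => hpair k (by omega), zero_add, hpair m (by omega)]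

/-- The sum of the production costs. -/
theorem sum_production_cost (n : ℕ) :
    ∑ j : Fin n, ((n : ℝ) - ((j : ℕ) + 1) + 1) = (n : ℝ) * (n + 1) / 2 := by
  induction n with
  | zero => simp
  | succ n ih =>
    rw [Fin.sum_univ_succ]
    have h : ∀ j : Fin n, (((n + 1 : ℕ) : ℝ) - ((j.succ : ℕ) + 1) + 1) =
        (n : ℝ) - ((j : ℕ) + 1) + 1 := by
      intro j
      push_cast [Fin.val_succ]
      ring
    rw [Finset.sum_congr rfl fun j _ => h j, ih]
    push_cast [Fin.val_zero]
    ring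

/-- for odd `n ≥ 3`, distinct `u, v ∈ S`, `ŷ = (u+v)/2` and `x̂`
as in the paper's construction, `Obj(x̂, ŷ) = n(n+1)/2 + n - N/2` where `N` is
the number of coordinates of `ŷ` equal to `1/2`. -/
theorem xhat_yhat_obj (n : ℕ) (hn : 3 ≤ n) (hodd : Odd n)
    (u v : Fin n → ℝ) (hu : u ∈ Sodd n) (hv : v ∈ Sodd n) (huv : u ≠ v)
    (xhat : Fin n → ℝ) (hx : XhatSpec n (fun j => (u j + v j) / 2) xhat) :
    Obj n xhat (fun j => (u j + v j) / 2) =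
      (n : ℝ) * (n + 1) / 2 + n -
        (1 / 2) * ({j : Fin n | (u j + v j) / 2 = 1 / 2}.ncard : ℝ) := by
  classical
  obtain ⟨m, hm⟩ := hodd
  obtain ⟨hxlast, hxodd, hxeven⟩ := hx
  obtain ⟨hu01, huodd⟩ := hu
  obtain ⟨hv01, hvodd⟩ := hv
  set y : Fin n → ℝ := fun j => (u j + v j) / 2 with hy
  have hy_cases : ∀ j, y j = 0 ∨ y j = 1 / 2 ∨ y j = 1 := by
    intro j
    rcases hu01 j with h | h <;> rcases hv01 j with h' | h' <;> norm_num [hy, h, h']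
  have hy_odd : ∀ j : Fin n, Odd ((j : ℕ) + 1) → y j = 1 := by
    intro j hj
    norm_num [hy, huodd j hj, hvodd j hj]
  let g : Fin n → ℝ := fun j => ((n : ℝ) - ((j : ℕ) + 1) + 1) * xhat j + y j
    - ((n : ℝ) - ((j : ℕ) + 1) + 1) - 1 + (1 / 2) * (if y j = 1 / 2 then 1 else 0)
  have hg : ∑ j, g j = 0 := by
    let G : ℕ → ℝ := fun k => if h : k < n then g ⟨k, h⟩ else 0
    have hG : ∑ j, g j = ∑ k ∈ Finset.range n, G k := by
      rw [Finset.sum_range]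
      exact Finset.sum_congr rfl fun j _ => by simp [G]
    rw [hG, hm]
    apply sum_range_eq_zero_of_pairs
    · intro k hk
      have h₀ : 2 * k < n := by omega
      have h₁ : 2 * k + 1 < n := by omega
      have hy₀ := hy_odd ⟨2 * k, h₀⟩ ⟨k, rfl⟩
      have hx₀ := hxodd ⟨2 * k, h₀⟩ h₁ ⟨k, rfl⟩
      have hx₁ := hxeven ⟨2 * k + 1, h₁⟩ ⟨k + 1, by simp only; ring⟩
      simp only [G, dif_pos h₀, dif_pos h₁, g, hy₀]
      rcases hy_cases ⟨2 * k + 1, h₁⟩ with h | h | h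
      · rw [hx₀.1 h, hx₁.1 h, h]
        push_cast
        norm_num
        ring
      · rw [hx₀.2 (Or.inl h), hx₁.2 (Or.inl h), h]
        norm_num
      · rw [hx₀.2 (Or.inr h), hx₁.2 (Or.inr h), h]
        norm_num
    · have h₀ : 2 * m < n := by omega
      simp only [G, dif_pos h₀, g, hxlast ⟨2 * m, h₀⟩ hm.symm, hy_odd ⟨2 * m, h₀⟩ ⟨m, rfl⟩]
      norm_num
  have hcard : (({j : Fin n | y j = 1 / 2}.ncard : ℕ) : ℝ) =
      ∑ j, if y j = 1 / 2 then (1 : ℝ) else 0 := by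
    rw [Finset.sum_boole, Set.ncard_eq_toFinset_card']
    simp
  change Obj n xhat y = (n : ℝ) * (n + 1) / 2 + n - (1 / 2) * ({j | y j = 1 / 2}.ncard : ℝ)
  rw [hcard, Obj, ← sum_production_cost]
  simp only [g, Finset.sum_add_distrib, Finset.sum_sub_distrib, ← Finset.mul_sum,
    Finset.sum_const, Finset.card_univ, Fintype.card_fin, nsmul_eq_mul] at hg ⊢
  linarith
end

section
/- Let n ≥ 3 be odd, let u, v ∈ S with u ≠ v, and set ŷ = (u + v)/2. Then there exists x̂ ∈ ℝ^n such that the pair (x̂, ŷ) is LP-feasible for the lot-sizing instance and Obj(x̂, ŷ) < n(n+1)/2 + n. -/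
open Finset

lemma sum_Iic_val_eq_sum_range {n : ℕ} (f : ℕ → ℝ) (i : Fin n) :
    ∑ k ∈ Finset.Iic i, f k = ∑ k ∈ Finset.range ((i : ℕ) + 1), f k := by
  rw [Nat.range_succ_eq_Iic, ← Fin.map_valEmbedding_Iic, Finset.sum_map]
  rfl

lemma sum_range_one_add_sub (e : ℕ → ℝ) (m : ℕ) :
    ∑ k ∈ Finset.range m, (1 + e (k + 1) - e k) = m + e m - e 0 := by
  induction m with
  | zero => simp
  | succ m ih => rw [Finset.sum_range_succ, ih]; push_cast; ring

lemma sum_range_sub_mul_one_add_sub (c : ℝ) (e : ℕ → ℝ) (m : ℕ) :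
    ∑ k ∈ Finset.range m, (c - (k + 1) + 1) * (1 + e (k + 1) - e k) =
      m * c - m * (m - 1) / 2 + (c - m + 1) * e m + ∑ k ∈ Finset.range m, e k
        - (c + 1) * e 0 := by
  induction m with
  | zero => simp
  | succ m ih => rw [Finset.sum_range_succ, Finset.sum_range_succ, ih]; push_cast; ring

/-- The indicator of the periods in which `y` vanishes, extended by zero beyond `n`. -/
noncomputable def zeroIndicator {n : ℕ} (y : Fin n → ℝ) (k : ℕ) : ℝ :=
  open Classical in if ∃ h : k < n, y ⟨k, h⟩ = 0 then 1 else 0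

lemma zeroIndicator_nonneg {n : ℕ} (y : Fin n → ℝ) (k : ℕ) : 0 ≤ zeroIndicator y k := by
  unfold zeroIndicator; split_ifs <;> norm_num

lemma zeroIndicator_le_one {n : ℕ} (y : Fin n → ℝ) (k : ℕ) : zeroIndicator y k ≤ 1 := by
  unfold zeroIndicator; split_ifs <;> norm_num

lemma zeroIndicator_of_le {n : ℕ} (y : Fin n → ℝ) {k : ℕ} (h : n ≤ k) :
    zeroIndicator y k = 0 :=
  if_neg fun ⟨h', _⟩ => absurd h' h.not_gt

lemma zeroIndicator_of_eq_zero {n : ℕ} {y : Fin n → ℝ} {j : Fin n} (h : y j = 0) :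
    zeroIndicator y j = 1 :=
  if_pos ⟨j.2, h⟩

lemma zeroIndicator_of_ne_zero {n : ℕ} {y : Fin n → ℝ} {j : Fin n} (h : y j ≠ 0) :
    zeroIndicator y j = 0 :=
  if_neg fun ⟨_, h'⟩ => h h'

lemma zeroIndicator_of_even {n : ℕ} {y : Fin n → ℝ}
    (hy : ∀ j : Fin n, Odd ((j : ℕ) + 1) → y j = 1) {k : ℕ} (hk : Even k) :
    zeroIndicator y k = 0 := by
  refine if_neg fun ⟨h, h0⟩ => ?_
  have := hy ⟨k, h⟩ hk.add_one
  linarith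

/-- Produce one unit in every period, moving the unit of each period where `y` vanishes
to the preceding period. -/
noncomputable def shiftedProduction {n : ℕ} (y : Fin n → ℝ) (j : Fin n) : ℝ :=
  1 + zeroIndicator y ((j : ℕ) + 1) - zeroIndicator y j

lemma lpFeasible_shiftedProduction {n : ℕ} (hodd : Odd n) {y : Fin n → ℝ}
    (hy : ∀ j : Fin n, Odd ((j : ℕ) + 1) → y j = 1)
    (hval : ∀ j, y j = 0 ∨ y j = 1 / 2 ∨ y j = 1) :
    LPFeasible n (shiftedProduction y) y := by
  have he0 : zeroIndicator y 0 = 0 := zeroIndicator_of_even hy Even.zero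
  refine ⟨fun i _ => ?_, ?_, fun j => ?_, fun j => ?_⟩
  · have h := sum_Iic_val_eq_sum_range
      (fun k => 1 + zeroIndicator y (k + 1) - zeroIndicator y k) i
    rw [sum_range_one_add_sub, he0] at h
    have := zeroIndicator_nonneg y ((i : ℕ) + 1)
    simp only [shiftedProduction]
    rw [h]
    push_cast
    linarith
  · have h := Fin.sum_univ_eq_sum_range
      (fun k => 1 + zeroIndicator y (k + 1) - zeroIndicator y k) n
    rw [sum_range_one_add_sub, he0, zeroIndicator_of_le y le_rfl] at h
    simp only [shiftedProduction]
    rw [h]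
    ring
  · have hnn := zeroIndicator_nonneg y ((j : ℕ) + 1)
    have hle := zeroIndicator_le_one y ((j : ℕ) + 1)
    have hjn : ((j : ℕ) : ℝ) + 1 ≤ n := by exact_mod_cast j.2
    simp only [shiftedProduction]
    rcases Nat.even_or_odd (j : ℕ) with hev | hod
    · rw [zeroIndicator_of_even hy hev, hy j hev.add_one]
      refine ⟨by linarith, ?_⟩
      rcases (Nat.succ_le_of_lt j.2).eq_or_lt with h | h
      · have := zeroIndicator_of_le y h.ge
        rw [Nat.succ_eq_add_one] at this
        linarith
      · have : ((j : ℕ) : ℝ) + 2 ≤ n := by exact_mod_cast h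
        linarith
    · rw [zeroIndicator_of_even hy hod.add_one]
      have hj2 : ((j : ℕ) : ℝ) + 2 ≤ n := by
        have : (j : ℕ) + 2 ≤ n := by
          have := j.2
          obtain ⟨a, ha⟩ := hodd
          obtain ⟨b, hb⟩ := hod
          omega
        exact_mod_cast this
      rcases hval j with h | h | h
      · rw [zeroIndicator_of_eq_zero h, h]; norm_num
      · rw [zeroIndicator_of_ne_zero (by rw [h]; norm_num), h]
        constructor <;> linarith
      · rw [zeroIndicator_of_ne_zero (by rw [h]; norm_num), h]
        constructor <;> linarith
  · rcases hval j with h | h | h <;> rw [h] <;> norm_num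

lemma obj_shiftedProduction {n : ℕ} {y : Fin n → ℝ}
    (hy : ∀ j : Fin n, Odd ((j : ℕ) + 1) → y j = 1) :
    Obj n (shiftedProduction y) y =
      (n : ℝ) * (n + 1) / 2 + ∑ j : Fin n, (zeroIndicator y j + y j) := by
  have h := Fin.sum_univ_eq_sum_range (fun k => ((n : ℝ) - (k + 1) + 1) *
    (1 + zeroIndicator y (k + 1) - zeroIndicator y k)) n
  rw [sum_range_sub_mul_one_add_sub, zeroIndicator_of_even hy Even.zero,
    zeroIndicator_of_le y le_rfl, ← Fin.sum_univ_eq_sum_range] at h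
  simp only [Obj, shiftedProduction]
  rw [h, Finset.sum_add_distrib]
  ring

/-- for odd `n ≥ 3` and distinct `u, v ∈ S`, with `ŷ = (u+v)/2`,
there is `x̂` so that `(x̂, ŷ)` is LP-feasible with objective strictly below
`n(n+1)/2 + n`. -/
theorem exists_xhat_better (n : ℕ) (hn : 3 ≤ n) (hodd : Odd n)
    (u v : Fin n → ℝ) (hu : u ∈ Sodd n) (hv : v ∈ Sodd n) (huv : u ≠ v) :
    ∃ xhat : Fin n → ℝ,
      LPFeasible n xhat (fun j => (u j + v j) / 2) ∧
      Obj n xhat (fun j => (u j + v j) / 2) < (n : ℝ) * (n + 1) / 2 + n := by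
  set y : Fin n → ℝ := fun j => (u j + v j) / 2 with hydef
  have hval : ∀ j, y j = 0 ∨ y j = 1 / 2 ∨ y j = 1 := fun j => by
    rcases hu.1 j with h | h <;> rcases hv.1 j with h' | h' <;> norm_num [hydef, h, h']
  have hy : ∀ j : Fin n, Odd ((j : ℕ) + 1) → y j = 1 := fun j hj => by
    norm_num [hydef, hu.2 j hj, hv.2 j hj]
  obtain ⟨i, hi⟩ := Function.ne_iff.1 huv
  have hhalf : y i = 1 / 2 := by
    rcases hu.1 i with h | h <;> rcases hv.1 i with h' | h' <;> simp_all
  refine ⟨shiftedProduction y, lpFeasible_shiftedProduction hodd hy hval, ?_⟩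
  rw [obj_shiftedProduction hy]
  have hlt : ∑ j : Fin n, (zeroIndicator y j + y j) < ∑ _j : Fin n, (1 : ℝ) := by
    refine Finset.sum_lt_sum (fun j _ => ?_) ⟨i, Finset.mem_univ i, ?_⟩
    · rcases hval j with h | h | h
      · rw [zeroIndicator_of_eq_zero h, h]; norm_num
      all_goals rw [zeroIndicator_of_ne_zero (by rw [h]; norm_num), h]; norm_num
    · rw [zeroIndicator_of_ne_zero (by rw [hhalf]; norm_num), hhalf]; norm_num
  simp only [Finset.sum_const, Finset.card_univ, Fintype.card_fin, nsmul_eq_mul, mul_one] at hlt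
  linarith
end

section
/- Let n ≥ 3 be odd and let C ⊆ ℝ^n be a convex set such that every LP-feasible pair (x, y) for the lot-sizing instance with y ∈ C satisfies Obj(x, y) ≥ n(n+1)/2 + n. Then C contains at most one element of S. -/
open Finset

/-- Production plan that moves the demand of every marked period to the preceding one:
`e k = 1` when the period with zero-based index `k` is marked, and `e k = 0` otherwise. -/
def shiftedPlan (e : ℕ → ℝ) (k : ℕ) : ℝ := 1 + e (k + 1) - e k

lemma sum_range_shiftedPlan (e : ℕ → ℝ) (h0 : e 0 = 0) (i : ℕ) :
    ∑ k ∈ range i, shiftedPlan e k = i + e i := by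
  induction i with
  | zero => simp [h0]
  | succ i ih =>
    rw [sum_range_succ, ih, shiftedPlan]
    push_cast
    ring

lemma sum_range_mul_shiftedPlan (e : ℕ → ℝ) (h0 : e 0 = 0) (N : ℝ) (i : ℕ) :
    ∑ k ∈ range i, (N - ((k : ℝ) + 1) + 1) * shiftedPlan e k =
      i * N - i * (i - 1) / 2 + (N - i + 1) * e i + ∑ k ∈ range i, e k := by
  induction i with
  | zero => simp [h0]
  | succ i ih =>
    rw [sum_range_succ, ih, sum_range_succ, shiftedPlan]
    push_cast
    ring

lemma Fin.sum_Iic_val {n : ℕ} (f : ℕ → ℝ) (i : Fin n) :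
    ∑ k ∈ Iic i, f k = ∑ k ∈ range ((i : ℕ) + 1), f k := by
  rw [Nat.range_succ_eq_Iic, ← Fin.map_valEmbedding_Iic, sum_map]
  rfl

lemma obj_shiftedPlan {n : ℕ} (e : ℕ → ℝ) (h0 : e 0 = 0) (hn : e n = 0) (y : Fin n → ℝ) :
    Obj n (fun j => shiftedPlan e j) y =
      (n : ℝ) * (n + 1) / 2 + ∑ j : Fin n, (e j + y j) := by
  rw [Obj, Fin.sum_univ_eq_sum_range
    (fun k => ((n : ℝ) - ((k : ℝ) + 1) + 1) * shiftedPlan e k) n,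
    sum_range_mul_shiftedPlan e h0, hn, sum_add_distrib, Fin.sum_univ_eq_sum_range e n]
  ring

lemma lpFeasible_shiftedPlan {n : ℕ} (e : ℕ → ℝ) (h0 : e 0 = 0) (hn : e n = 0)
    (he : ∀ k, 0 ≤ e k) (y : Fin n → ℝ)
    (hx : ∀ j : Fin n, 0 ≤ shiftedPlan e j ∧ shiftedPlan e j ≤ ((n : ℝ) - j) * y j)
    (hy : ∀ j, 0 ≤ y j ∧ y j ≤ 1) :
    LPFeasible n (fun j => shiftedPlan e j) y := by
  refine ⟨fun i _ => ?_, ?_, fun j => ⟨(hx j).1, ?_⟩, hy⟩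
  · rw [Fin.sum_Iic_val (shiftedPlan e), sum_range_shiftedPlan e h0]
    push_cast
    linarith [he (i + 1)]
  · rw [Fin.sum_univ_eq_sum_range (shiftedPlan e), sum_range_shiftedPlan e h0, hn, add_zero]
  · calc shiftedPlan e j ≤ ((n : ℝ) - j) * y j := (hx j).2
      _ = _ := by ring

lemma exists_lpFeasible_midpoint_obj_lt {n : ℕ} (hodd : Odd n) {y z : Fin n → ℝ}
    (hy : y ∈ Sodd n) (hz : z ∈ Sodd n) (hne : y ≠ z) :
    ∃ x, LPFeasible n x (midpoint ℝ y z) ∧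
      Obj n x (midpoint ℝ y z) < (n : ℝ) * (n + 1) / 2 + n := by
  classical
  obtain ⟨hy01, hy1⟩ := hy
  obtain ⟨hz01, hz1⟩ := hz
  have hm : ∀ j, midpoint ℝ y z j = (y j + z j) / 2 := fun j => by
    simp [midpoint_eq_smul_add]
    ring
  set P : ℕ → Prop := fun k => ∃ h : k < n, y ⟨k, h⟩ = 0 ∧ z ⟨k, h⟩ = 0 with hP
  set e : ℕ → ℝ := fun k => if P k then 1 else 0 with he
  have hP_odd : ∀ k, P k → Odd k := by
    rintro k ⟨h, hk, -⟩
    by_contra hk'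
    have := hy1 ⟨k, h⟩ (Nat.not_odd_iff_even.mp hk').add_one
    linarith
  have hP_lt : ∀ k, P k → k < n := fun k h => h.1
  have hP_fin : ∀ j : Fin n, P j ↔ y j = 0 ∧ z j = 0 := fun j => by simp [hP]
  have h0 : e 0 = 0 := if_neg fun h => by simpa using hP_odd 0 h
  have hn : e n = 0 := if_neg fun h => (hP_lt n h).false
  have he0 : ∀ k, 0 ≤ e k := fun k => by simp only [he]; split_ifs <;> norm_num
  refine ⟨fun j => shiftedPlan e j, lpFeasible_shiftedPlan e h0 hn he0 _ (fun j => ?_)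
    (fun j => ?_), ?_⟩
  · have hj1 : (j : ℝ) + 1 ≤ n := by exact_mod_cast j.isLt
    rw [hm, shiftedPlan]
    by_cases hj : P j
    · have hs : ¬ P (j + 1) := fun h => by
        have h1 := hP_odd _ h
        have h2 := hP_odd _ hj
        grind
      have hyz := (hP_fin j).mp hj
      simp [he, hj, hs, hyz]
    · rcases Nat.even_or_odd (j : ℕ) with hev | hod
      · rw [hy1 j hev.add_one, hz1 j hev.add_one]
        by_cases hs : P (j + 1)
        · have hj2 : (j : ℝ) + 1 + 1 ≤ n := by exact_mod_cast hP_lt _ hs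
          simp only [he, hj, hs, if_true, if_false]
          constructor <;> linarith
        · simp only [he, hj, hs, if_false]
          constructor <;> linarith
      · have hs : ¬ P (j + 1) := fun h => by
          have := hP_odd _ h
          grind
        have hj2 : (j : ℝ) + 1 + 1 ≤ n := by
          have : (j : ℕ) + 1 + 1 ≤ n := by
            have := j.isLt
            grind
          exact_mod_cast this
        simp only [he, hj, hs, if_false]
        rw [hP_fin] at hj
        rcases hy01 j with h | h <;> rcases hz01 j with h' | h' <;> rw [h, h']
        · exact absurd ⟨h, h'⟩ hj
        all_goals constructor <;> linarith
  · rw [hm]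
    rcases hy01 j with h | h <;> rcases hz01 j with h' | h' <;> rw [h, h'] <;> norm_num
  · rw [obj_shiftedPlan e h0 hn]
    obtain ⟨i, hi⟩ := Function.ne_iff.mp hne
    have hlt : ∑ j : Fin n, (e j + midpoint ℝ y z j) < ∑ _j : Fin n, (1 : ℝ) := by
      refine sum_lt_sum (fun j _ => ?_) ⟨i, mem_univ i, ?_⟩
      · simp only [hm, he, hP_fin]
        rcases hy01 j with h | h <;> rcases hz01 j with h' | h' <;> rw [h, h'] <;> norm_num
      · simp only [hm, he, hP_fin]
        rcases hy01 i with h | h <;> rcases hz01 i with h' | h' <;> rw [h, h'] at hi ⊢ <;>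
          first | exact absurd rfl hi | norm_num
    simpa using hlt

/-- for odd `n ≥ 3`, a convex set `C` over which the LP value is
at least the integer optimum contains at most one element of `S`. -/
theorem convex_pruned_at_most_one_Sodd (n : ℕ) (hn : 3 ≤ n) (hodd : Odd n)
    (C : Set (Fin n → ℝ)) (hC : Convex ℝ C)
    (hbound : ∀ x y : Fin n → ℝ, LPFeasible n x y → y ∈ C →
      Obj n x y ≥ (n : ℝ) * (n + 1) / 2 + n) :
    (C ∩ Sodd n).Subsingleton := by
  rintro y ⟨hyC, hy⟩ z ⟨hzC, hz⟩
  by_contra hne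
  obtain ⟨x, hx, hlt⟩ := exists_lpFeasible_midpoint_obj_lt hodd hy hz hne
  exact (hbound x _ hx (hC.midpoint_mem hyC hzC)).not_gt hlt
end

section
/- Let n ≥ 3 be odd and let (C_i)_{i ∈ I} be a finite family of convex subsets of ℝ^n such that (a) every y ∈ S lies in C_i for some i ∈ I, and (b) for every i ∈ I, every LP-feasible pair (x, y) for the lot-sizing instance with y ∈ C_i satisfies Obj(x, y) ≥ n(n+1)/2 + n. Then |I| ≥ 2^{(n-1)/2}. -/
open Finset

/-- A half-integral setup vector that equals `1` at every even index and takes the value `1/2`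
somewhere admits a production plan that is strictly cheaper than the integer optimum. -/
theorem exists_LPFeasible_Obj_lt (n : ℕ) (z : ℕ → ℝ)
    (hz : ∀ k, z k = 1 ∨ (Odd k ∧ k + 1 < n ∧ (z k = 0 ∨ z k = 1 / 2)))
    (hhalf : ∃ k < n, z k = 1 / 2) :
    ∃ x : Fin n → ℝ, LPFeasible n x (fun j => z j) ∧
      Obj n x (fun j => z j) < (n : ℝ) * (n + 1) / 2 + n := by
  let e : ℕ → ℝ := fun k => if z k = 0 then 1 else 0
  have he_one (k : ℕ) (h : z k = 1) : e k = 0 := by simp [e, h]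
  have he_half (k : ℕ) (h : z k = 1 / 2) : e k = 0 := by simp [e, h]
  have he_zero (k : ℕ) (h : z k = 0) : e k = 1 := by simp [e, h]
  have hz_even (k : ℕ) (hk : ¬ Odd k) : z k = 1 := (hz k).resolve_right fun h => hk h.1
  have he_first : e 0 = 0 := he_one 0 (hz_even 0 (by decide))
  have he_last : e n = 0 := he_one n ((hz n).resolve_right fun h => by omega)
  have he_nonneg (k : ℕ) : 0 ≤ e k := by simp only [e]; split_ifs <;> norm_num
  have prefix_sum (m : ℕ) : ∑ k ∈ range m, (1 - e k + e (k + 1)) = m + e m := by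
    induction m with
    | zero => simp [he_first]
    | succ m ih => rw [sum_range_succ, ih]; push_cast; ring
  have weighted_sum (c : ℝ) (m : ℕ) :
      ∑ k ∈ range m, (c - ((k : ℝ) + 1) + 1) * (1 - e k + e (k + 1)) =
        c * m - m * (m - 1) / 2 + ∑ k ∈ range m, e k + (c - m + 1) * e m := by
    induction m with
    | zero => simp [he_first]
    | succ m ih => rw [sum_range_succ, sum_range_succ, ih]; push_cast; ring
  refine ⟨fun j => 1 - e j + e (j + 1), ⟨?_, ?_, ?_, ?_⟩, ?_⟩
  · intro i _
    have h := sum_map (Iic i) Fin.valEmbedding (fun k : ℕ => 1 - e k + e (k + 1))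
    rw [Fin.map_valEmbedding_Iic, ← Nat.range_succ_eq_Iic, prefix_sum] at h
    simp only [Fin.valEmbedding_apply] at h
    rw [← h]
    push_cast
    linarith [he_nonneg (i + 1)]
  · rw [Fin.sum_univ_eq_sum_range (fun k : ℕ => 1 - e k + e (k + 1)), prefix_sum, he_last, add_zero]
  · intro j
    have hj : ((j : ℕ) : ℝ) + 1 ≤ n := by exact_mod_cast j.isLt
    rcases hz j with h | ⟨hodd, hlt, h⟩
    · simp only [he_one j h, h]
      rcases hz (j + 1) with h' | ⟨-, hlt, h' | h'⟩
      · rw [he_one _ h']; constructor <;> linarith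
      · have : ((j : ℕ) : ℝ) + 1 + 1 ≤ n := by exact_mod_cast hlt.le
        rw [he_zero _ h']; constructor <;> linarith
      · rw [he_half _ h']; constructor <;> linarith
    · have : ((j : ℕ) : ℝ) + 1 + 1 ≤ n := by exact_mod_cast hlt
      have hnext : e (j + 1) = 0 := he_one _ (hz_even _ (by grind))
      rcases h with h | h
      · simp [hnext, he_zero _ h, h]
      · simp only [hnext, he_half _ h, h]
        constructor <;> linarith
  · intro j
    rcases hz j with h | ⟨-, -, h | h⟩ <;> simp only [h] <;> norm_num
  · have hlt : ∑ k ∈ range n, (e k + z k) < ∑ k ∈ range n, (1 : ℝ) := by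
      obtain ⟨k₀, hk₀, h₀⟩ := hhalf
      refine sum_lt_sum (fun k _ => ?_) ⟨k₀, mem_range.2 hk₀, ?_⟩
      · rcases hz k with h | ⟨-, -, h | h⟩
        · rw [he_one _ h, h]; norm_num
        · rw [he_zero _ h, h]; norm_num
        · rw [he_half _ h, h]; norm_num
      · rw [he_half _ h₀, h₀]; norm_num
    simp only [sum_add_distrib, sum_const, card_range, nsmul_eq_mul, mul_one] at hlt
    unfold Obj
    rw [Fin.sum_univ_eq_sum_range
        (fun k : ℕ => ((n : ℝ) - ((k : ℝ) + 1) + 1) * (1 - e k + e (k + 1))),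
      Fin.sum_univ_eq_sum_range z, weighted_sum, he_last]
    linarith

/-- The setup vector with a unit at every even index and the bit `f i` at index `2 * i + 1`. -/
def bitSetup {m : ℕ} (f : Fin m → Bool) (k : ℕ) : ℝ :=
  if h : Odd k ∧ k / 2 < m then (if f ⟨k / 2, h.2⟩ then 1 else 0) else 1

theorem bitSetup_eq_zero_or_one {m : ℕ} (f : Fin m → Bool) (k : ℕ) :
    bitSetup f k = 0 ∨ bitSetup f k = 1 := by
  unfold bitSetup
  split_ifs <;> simp

theorem bitSetup_of_not {m : ℕ} (f : Fin m → Bool) {k : ℕ} (h : ¬ (Odd k ∧ k / 2 < m)) :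
    bitSetup f k = 1 :=
  dif_neg h

theorem bitSetup_two_mul_add_one {m : ℕ} (f : Fin m → Bool) (i : Fin m) :
    bitSetup f (2 * i + 1) = if f i then 1 else 0 := by
  have h : (2 * (i : ℕ) + 1) / 2 = i := by omega
  simp [bitSetup, h]

theorem bitSetup_mem_Sodd {m : ℕ} (n : ℕ) (f : Fin m → Bool) :
    (fun j : Fin n => bitSetup f j) ∈ Sodd n :=
  ⟨fun j => bitSetup_eq_zero_or_one f j, fun j hj => bitSetup_of_not f (by grind)⟩

/-- for odd `n ≥ 3`, any finite family of convex sets covering `S`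
on which the LP value is at least the integer optimum has at least
`2^{(n-1)/2}` members. -/
theorem leaf_lower_bound_odd (n : ℕ) (hn : 3 ≤ n) (hodd : Odd n)
    {ι : Type*} [Fintype ι] (C : ι → Set (Fin n → ℝ))
    (hconv : ∀ i, Convex ℝ (C i))
    (hcover : ∀ y ∈ Sodd n, ∃ i, y ∈ C i)
    (hbound : ∀ i, ∀ x y : Fin n → ℝ, LPFeasible n x y → y ∈ C i →
      Obj n x y ≥ (n : ℝ) * (n + 1) / 2 + n) :
    2 ^ ((n - 1) / 2) ≤ Fintype.card ι := by
  obtain ⟨m, rfl⟩ := hodd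
  rw [show (2 * m + 1 - 1) / 2 = m by omega]
  choose leaf hleaf using fun f : Fin m → Bool => hcover _ (bitSetup_mem_Sodd (2 * m + 1) f)
  suffices h : Function.Injective leaf by
    simpa using Fintype.card_le_of_injective leaf h
  intro f g hfg
  by_contra hne
  obtain ⟨i, hi⟩ := Function.ne_iff.1 hne
  let z : ℕ → ℝ := fun k => (1 / 2) * bitSetup f k + (1 / 2) * bitSetup g k
  have hmem : (fun j : Fin (2 * m + 1) => z j) ∈ C (leaf f) :=
    hconv (leaf f) (hleaf f) (hfg ▸ hleaf g) (by norm_num) (by norm_num) (by norm_num)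
  obtain ⟨x, hfeas, hlt⟩ := exists_LPFeasible_Obj_lt (2 * m + 1) z (fun k => by
    by_cases hk : Odd k ∧ k / 2 < m
    · have hlt : k + 1 < 2 * m + 1 := by grind
      simp only [z, hk.1, hlt, true_and]
      rcases bitSetup_eq_zero_or_one f k with h | h <;>
        rcases bitSetup_eq_zero_or_one g k with h' | h' <;> rw [h, h'] <;> norm_num
    · left
      simp only [z, bitSetup_of_not _ hk]
      norm_num) ⟨2 * i + 1, by omega, by
    simp only [z, bitSetup_two_mul_add_one]
    cases hf : f i <;> cases hg : g i <;> simp_all⟩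
  exact absurd (hbound _ x _ hfeas hmem) (not_le.2 hlt)
end

section
/- Let n ≥ 2 and let (C_i)_{i ∈ I} be a finite family of convex subsets of ℝ^n such that (a) every integer-feasible pair (x, y) for the lot-sizing instance has y ∈ C_i for some i ∈ I, and (b) for every i ∈ I, every LP-feasible pair (x, y) with y ∈ C_i satisfies Obj(x, y) ≥ n(n+1)/2 + n. Then the cardinality of I is at least (2 : ℝ)^{n/2 − 1} (real exponent). -/
open Finset

/-- Indicator of the periods (counted from `0`) of the form `2 * t + 1` with `t ∈ S`. -/
def skipped (S : Finset ℕ) (k : ℕ) : ℝ := if k % 2 = 1 ∧ k / 2 ∈ S then 1 else 0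

/-- The midpoint of the setup vectors that skip exactly the periods marked by `S` and by `T`. -/
noncomputable def setup (n : ℕ) (S T : Finset ℕ) (k : Fin n) : ℝ :=
  1 - (skipped S k + skipped T k) / 2

/-- One unit per period, where each period marked by `Z` is served by its predecessor. -/
def production (n : ℕ) (Z : Finset ℕ) (k : Fin n) : ℝ :=
  1 - skipped Z k + skipped Z (k + 1)

lemma sum_Iic_fin {n : ℕ} (i : Fin n) (f : ℕ → ℝ) :
    ∑ k ∈ Finset.Iic i, f k = ∑ k ∈ Finset.range (i + 1), f k := by
  have h : Finset.range ((i : ℕ) + 1) = (Finset.Iic i).map Fin.valEmbedding := by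
    rw [Fin.map_valEmbedding_Iic]
    ext k
    simp
  rw [h, Finset.sum_map]
  rfl

lemma skipped_nonneg (S : Finset ℕ) (k : ℕ) : 0 ≤ skipped S k := by
  unfold skipped
  split_ifs <;> norm_num

lemma skipped_zero (S : Finset ℕ) : skipped S 0 = 0 := by simp [skipped]

lemma skipped_eq_zero_of_le {n k : ℕ} {S : Finset ℕ} (hS : S ⊆ Finset.range ((n - 1) / 2))
    (hk : n ≤ k + 1) : skipped S k = 0 := by
  unfold skipped
  rw [if_neg]
  rintro ⟨h1, h2⟩
  have := Finset.mem_range.1 (hS h2)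
  omega

lemma sum_range_production (Z : Finset ℕ) (m : ℕ) :
    ∑ k ∈ Finset.range m, (1 - skipped Z k + skipped Z (k + 1)) = m + skipped Z m := by
  induction m with
  | zero => simp [skipped_zero]
  | succ m ih =>
    rw [Finset.sum_range_succ, ih]
    push_cast
    ring

lemma sum_range_production_cost (Z : Finset ℕ) (c : ℝ) (m : ℕ) :
    ∑ k ∈ Finset.range m, (c - (k + 1) + 1) * (1 - skipped Z k + skipped Z (k + 1)) =
      c * m - m * (m - 1) / 2 + ∑ k ∈ Finset.range m, skipped Z k + (c - m + 1) * skipped Z m := by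
  induction m with
  | zero => simp [skipped_zero]
  | succ m ih =>
    rw [Finset.sum_range_succ, Finset.sum_range_succ, ih]
    push_cast
    ring

lemma production_le_capacity {n : ℕ} {S T : Finset ℕ} (hS : S ⊆ Finset.range ((n - 1) / 2))
    (hT : T ⊆ Finset.range ((n - 1) / 2)) (k : Fin n) :
    production n (S ∩ T) k ≤ ((n : ℝ) - ((k : ℕ) + 1) + 1) * setup n S T k := by
  obtain ⟨k, hk⟩ := k
  have h1 : (k : ℝ) + 1 ≤ n := by exact_mod_cast hk
  rcases Nat.even_or_odd' k with ⟨t, rfl | rfl⟩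
  · have e1 : 2 * t % 2 ≠ 1 := by omega
    have e2 : (2 * t + 1) % 2 = 1 := by omega
    have e3 : (2 * t + 1) / 2 = t := by omega
    simp only [production, setup, skipped, e1, e2, e3, false_and, true_and, if_false]
    split_ifs with h
    · have := Finset.mem_range.1 (hS (Finset.mem_inter.1 h).1)
      have h2 : ((2 * t : ℕ) : ℝ) + 2 ≤ n := by exact_mod_cast (by omega : 2 * t + 2 ≤ n)
      linarith
    · linarith
  · have e1 : (2 * t + 1 + 1) % 2 ≠ 1 := by omega
    have e2 : (2 * t + 1) % 2 = 1 := by omega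
    have e3 : (2 * t + 1) / 2 = t := by omega
    simp only [production, setup, skipped, e1, e2, e3, false_and, true_and, if_false,
      Finset.mem_inter]
    have h2 : t ∈ S ∨ t ∈ T → ((2 * t + 1 : ℕ) : ℝ) + 2 ≤ n := by
      intro h
      have : t < (n - 1) / 2 := h.elim (fun h ↦ Finset.mem_range.1 (hS h))
        (fun h ↦ Finset.mem_range.1 (hT h))
      exact_mod_cast (by omega : 2 * t + 1 + 2 ≤ n)
    by_cases hs : t ∈ S <;> by_cases ht : t ∈ T <;>
      simp only [hs, ht, true_or, or_true, forall_true_left, and_self, and_true,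
        if_true, if_false, and_false] at h2 ⊢ <;> linarith

lemma lpFeasible_setup {n : ℕ} {S T : Finset ℕ} (hS : S ⊆ Finset.range ((n - 1) / 2))
    (hT : T ⊆ Finset.range ((n - 1) / 2)) :
    LPFeasible n (production n (S ∩ T)) (setup n S T) := by
  have hle (S : Finset ℕ) (k : ℕ) : skipped S k ≤ 1 := by
    unfold skipped
    split_ifs <;> norm_num
  refine ⟨fun i _ ↦ ?_, ?_, fun j ↦ ⟨?_, production_le_capacity hS hT j⟩, fun j ↦ ⟨?_, ?_⟩⟩
  · have h := sum_Iic_fin i fun k ↦ 1 - skipped (S ∩ T) k + skipped (S ∩ T) (k + 1)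
    rw [sum_range_production] at h
    have h0 := skipped_nonneg (S ∩ T) (i + 1)
    push_cast at h
    simp only [production]
    linarith
  · have h := Fin.sum_univ_eq_sum_range
      (fun k ↦ 1 - skipped (S ∩ T) k + skipped (S ∩ T) (k + 1)) n
    rw [sum_range_production, skipped_eq_zero_of_le (Finset.inter_subset_left.trans hS)
      (Nat.le_succ n), add_zero] at h
    exact h
  · have := hle (S ∩ T) j
    have := skipped_nonneg (S ∩ T) (j + 1)
    unfold production
    linarith
  · have := hle S j
    have := hle T j
    unfold setup
    linarith
  · have := skipped_nonneg S j
    have := skipped_nonneg T j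
    unfold setup
    linarith

lemma obj_setup {n : ℕ} {S T : Finset ℕ} (hS : S ⊆ Finset.range ((n - 1) / 2)) :
    Obj n (production n (S ∩ T)) (setup n S T) = (n : ℝ) * (n + 1) / 2 + n -
      ∑ k ∈ Finset.range n, ((skipped S k + skipped T k) / 2 - skipped (S ∩ T) k) := by
  have h1 := Fin.sum_univ_eq_sum_range
    (fun k ↦ ((n : ℝ) - (k + 1) + 1) * (1 - skipped (S ∩ T) k + skipped (S ∩ T) (k + 1))) n
  rw [sum_range_production_cost, skipped_eq_zero_of_le (Finset.inter_subset_left.trans hS)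
    (Nat.le_succ n)] at h1
  have h2 := Fin.sum_univ_eq_sum_range (fun k ↦ 1 - (skipped S k + skipped T k) / 2) n
  simp only [Obj, production, setup]
  rw [h1, h2, Finset.sum_sub_distrib, Finset.sum_sub_distrib, Finset.sum_const, Finset.card_range,
    nsmul_eq_mul]
  ring

lemma obj_setup_lt {n : ℕ} {S T : Finset ℕ} (hS : S ⊆ Finset.range ((n - 1) / 2))
    (hT : T ⊆ Finset.range ((n - 1) / 2)) (hST : S ≠ T) :
    Obj n (production n (S ∩ T)) (setup n S T) < (n : ℝ) * (n + 1) / 2 + n := by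
  rw [obj_setup hS]
  refine sub_lt_self _ (Finset.sum_pos' (fun k _ ↦ ?_) ?_)
  · simp only [skipped, Finset.mem_inter]
    by_cases h : k % 2 = 1 <;> by_cases hs : k / 2 ∈ S <;> by_cases ht : k / 2 ∈ T <;>
      simp [h, hs, ht]
  · obtain ⟨t, ht⟩ : ∃ t, ¬(t ∈ S ↔ t ∈ T) := by
      by_contra! h
      exact hST (Finset.ext h)
    have e2 : (2 * t + 1) % 2 = 1 := by omega
    have e3 : (2 * t + 1) / 2 = t := by omega
    refine ⟨2 * t + 1, ?_, ?_⟩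
    · have : t < (n - 1) / 2 := by
        by_cases h : t ∈ S
        · exact Finset.mem_range.1 (hS h)
        · exact Finset.mem_range.1 (hT (by tauto))
      exact Finset.mem_range.2 (by omega)
    · simp only [skipped, e2, e3, true_and, Finset.mem_inter]
      by_cases hs : t ∈ S <;> by_cases h : t ∈ T <;> simp_all

lemma intFeasible_setup_self {n : ℕ} {S : Finset ℕ} (hS : S ⊆ Finset.range ((n - 1) / 2)) :
    IntFeasible n (production n (S ∩ S)) (setup n S S) := by
  refine ⟨lpFeasible_setup hS hS, fun j ↦ ?_⟩
  simp only [setup, skipped]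
  split_ifs <;> norm_num

lemma setup_mem_of_convex {n : ℕ} {S T : Finset ℕ} {C : Set (Fin n → ℝ)} (hC : Convex ℝ C)
    (hS : setup n S S ∈ C) (hT : setup n T T ∈ C) : setup n S T ∈ C := by
  convert hC hS hT (a := 1 / 2) (b := 1 / 2) (by norm_num) (by norm_num) (by norm_num) using 1
  ext k
  simp only [setup, Pi.add_apply, Pi.smul_apply, smul_eq_mul]
  ring

/-- Theorem 1 of the paper: for `n ≥ 2`, any finite family of
convex sets covering the `y`-parts of all integer-feasible pairs, on which the
LP value is at least the integer optimum, has at least `2^{n/2 - 1}` members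
(real exponent). -/
theorem leaf_lower_bound (n : ℕ) (hn : 2 ≤ n)
    {ι : Type*} [Fintype ι] (C : ι → Set (Fin n → ℝ))
    (hconv : ∀ i, Convex ℝ (C i))
    (hcover : ∀ x y : Fin n → ℝ, IntFeasible n x y → ∃ i, y ∈ C i)
    (hbound : ∀ i, ∀ x y : Fin n → ℝ, LPFeasible n x y → y ∈ C i →
      Obj n x y ≥ (n : ℝ) * (n + 1) / 2 + n) :
    (Fintype.card ι : ℝ) ≥ (2 : ℝ) ^ ((n : ℝ) / 2 - 1) := by
  choose g hg using fun S : (Finset.range ((n - 1) / 2)).powerset ↦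
    hcover _ _ (intFeasible_setup_self (Finset.mem_powerset.1 S.2))
  have hinj : Function.Injective g := by
    intro S T h
    by_contra hne
    have hS := Finset.mem_powerset.1 S.2
    have hT := Finset.mem_powerset.1 T.2
    have hmem := setup_mem_of_convex (hconv (g S)) (hg S) (h ▸ hg T)
    exact (hbound _ _ _ (lpFeasible_setup hS hT) hmem).not_gt
      (obj_setup_lt hS hT fun h' ↦ hne (Subtype.ext h'))
  have hcard := Fintype.card_le_of_injective g hinj
  rw [Fintype.card_coe, Finset.card_powerset, Finset.card_range] at hcard
  have hexp : (n : ℝ) / 2 - 1 ≤ ((n - 1) / 2 : ℕ) := by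
    have : (n : ℝ) ≤ 2 * ((n - 1) / 2 : ℕ) + 2 := by
      exact_mod_cast (by omega : n ≤ 2 * ((n - 1) / 2) + 2)
    linarith
  calc (2 : ℝ) ^ ((n : ℝ) / 2 - 1) ≤ (2 : ℝ) ^ (((n - 1) / 2 : ℕ) : ℝ) :=
        Real.rpow_le_rpow_of_exponent_le (by norm_num) hexp
    _ = ((2 ^ ((n - 1) / 2) : ℕ) : ℝ) := by rw [Real.rpow_natCast]; push_cast; rfl
    _ ≤ Fintype.card ι := by exact_mod_cast hcard
end

section
/- For every n ≥ 1 and every integer-feasible pair (x, y) for the lot-sizing instance and every j ∈ {2,...,n}: if y_j = 1 then the cost contribution f_j + p_j of producing the demand of period j in period j equals n − j + 2, and if y_j = 0 then for every earlier period i < j the unit production cost satisfies p_i = n − i + 1 ≥ n − j + 2; consequently the objective of any integer-feasible pair is at least ∑_{j=1}^n (n − j + 2) = n(n+1)/2 + n. -/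
open Finset

/-- Unit production cost `p_j = n - j + 1` of period `(j : ℕ) + 1`. -/
def pcost (n : ℕ) (j : Fin n) : ℝ := (n : ℝ) - ((j : ℕ) + 1) + 1

/-- Fixed cost `f_j = 1`. -/
def fcost (n : ℕ) (_j : Fin n) : ℝ := 1

/-- If the prefix sums of `X` satisfy `S m ≥ m` and each period either pays a unit setup or has
zero production, then the cost of the first `m` periods exceeds `m (m + 1) / 2 + m` by at least
the slack `S m - m`. -/
theorem prefix_cost_lower_bound (n : ℕ) (X Y : ℕ → ℝ)
    (hS : ∀ m ≤ n, (m : ℝ) ≤ ∑ k ∈ range m, X k)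
    (hY : ∀ k < n, Y k = 1 ∨ (Y k = 0 ∧ X k = 0)) (m : ℕ) (hm : m ≤ n) :
    (m : ℝ) * (m + 1) / 2 + m + (∑ k ∈ range m, X k - m) ≤
      ∑ k ∈ range m, ((m : ℝ) - k) * X k + ∑ k ∈ range m, Y k := by
  induction m with
  | zero => simp
  | succ m ih =>
    have ih := ih (by omega)
    have hcost : ∑ k ∈ range (m + 1), (((m + 1 : ℕ) : ℝ) - k) * X k =
        ∑ k ∈ range m, ((m : ℝ) - k) * X k + ∑ k ∈ range (m + 1), X k := by
      rw [sum_range_succ, sum_range_succ X, ← add_assoc, ← sum_add_distrib]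
      push_cast
      congr 1
      · exact sum_congr rfl fun k _ => by ring
      · ring
    have hm0 := hS m (by omega)
    have hm1 := hS (m + 1) hm
    rw [hcost]
    rw [sum_range_succ] at hm1 ⊢
    rw [sum_range_succ Y]
    push_cast at hm1 ⊢
    rcases hY m (by omega) with h | ⟨h, h'⟩
    · rw [h]
      linarith
    · rw [h'] at hm1 ⊢
      rw [h]
      linarith

/-- Objective lower bound for integer-feasible pairs. -/
theorem obj_lower_bound (n : ℕ) (x y : Fin n → ℝ) (hxy : IntFeasible n x y) :
    (n : ℝ) * (n + 1) / 2 + n ≤ Obj n x y := by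
  obtain ⟨⟨hpre, htot, hx, -⟩, hint⟩ := hxy
  let X : ℕ → ℝ := fun k => if h : k < n then x ⟨k, h⟩ else 0
  let Y : ℕ → ℝ := fun k => if h : k < n then y ⟨k, h⟩ else 0
  have hX : ∀ k : Fin n, X k = x k := fun k => by simp [X]
  have hYv : ∀ k : Fin n, Y k = y k := fun k => by simp [Y]
  have hsum : ∑ k ∈ range n, X k = n := by
    rw [sum_range, ← htot]
    exact sum_congr rfl fun k _ => hX k
  have hS : ∀ m ≤ n, (m : ℝ) ≤ ∑ k ∈ range m, X k := by
    intro m hm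
    rcases hm.eq_or_lt with rfl | hlt
    · exact hsum.ge
    · rcases m with _ | m
      · simp
      · have h := hpre ⟨m, by omega⟩ (by simp only; omega)
        rw [Nat.range_succ_eq_Iic, ← Fin.map_valEmbedding_Iic (⟨m, by omega⟩ : Fin n), sum_map]
        simpa [hX] using h
  have hY : ∀ k < n, Y k = 1 ∨ (Y k = 0 ∧ X k = 0) := by
    intro k hk
    rw [hYv ⟨k, hk⟩, hX ⟨k, hk⟩]
    rcases hint ⟨k, hk⟩ with h | h
    · have hb := hx ⟨k, hk⟩
      rw [h, mul_zero] at hb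
      exact Or.inr ⟨h, le_antisymm hb.2 hb.1⟩
    · exact Or.inl h
  have key := prefix_cost_lower_bound n X Y hS hY n le_rfl
  rw [hsum, sub_self, add_zero, sum_range, sum_range] at key
  simp only [hX, hYv] at key
  refine key.trans_eq ?_
  unfold Obj
  congr 1
  exact sum_congr rfl fun k _ => by ring

/-- Closed form of `∑_{j=1}^n (n - j + 2)`. -/
theorem sum_period_cost (n : ℕ) :
    ∑ j : Fin n, ((n : ℝ) - ((j : ℕ) + 1) + 2) = (n : ℝ) * (n + 1) / 2 + n := by
  have hid : ∀ m : ℕ, ∑ k ∈ range m, (k : ℝ) = (m : ℝ) * (m - 1) / 2 := by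
    intro m
    induction m with
    | zero => simp
    | succ m ih =>
      rw [sum_range_succ, ih]
      push_cast
      ring
  have h : ∀ j : Fin n, (n : ℝ) - ((j : ℕ) + 1) + 2 = (n + 1) - (j : ℕ) := fun j => by ring
  simp only [h]
  rw [sum_sub_distrib, ← sum_range (fun k : ℕ => (k : ℝ)), hid]
  simp only [sum_const, card_univ, Fintype.card_fin, nsmul_eq_mul]
  ring

/-- the local exchange argument of Claim 1 and its consequence.
For every integer-feasible pair and every period `j ≥ 2`: if `y_j = 1` then
`f_j + p_j = n - j + 2`; if `y_j = 0` then `p_i = n - i + 1 ≥ n - j + 2` for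
every earlier period `i < j`; consequently the objective is at least
`∑_{j=1}^n (n - j + 2) = n(n+1)/2 + n`. -/
theorem claim_cost_cases (n : ℕ) (hn : 1 ≤ n) (x y : Fin n → ℝ)
    (hxy : IntFeasible n x y) :
    (∀ j : Fin n, 2 ≤ (j : ℕ) + 1 →
      (y j = 1 → fcost n j + pcost n j = (n : ℝ) - ((j : ℕ) + 1) + 2) ∧
      (y j = 0 → ∀ i : Fin n, (i : ℕ) < (j : ℕ) →
        pcost n i = (n : ℝ) - ((i : ℕ) + 1) + 1 ∧
        pcost n i ≥ (n : ℝ) - ((j : ℕ) + 1) + 2)) ∧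
    ((∑ j : Fin n, ((n : ℝ) - ((j : ℕ) + 1) + 2)) = (n : ℝ) * (n + 1) / 2 + n) ∧
    Obj n x y ≥ (n : ℝ) * (n + 1) / 2 + n := by
  refine ⟨fun j _ => ⟨fun _ => ?_, fun _ i hij => ⟨rfl, ?_⟩⟩, sum_period_cost n,
    obj_lower_bound n x y hxy⟩
  · unfold fcost pcost
    ring
  · have h : ((i : ℕ) : ℝ) + 1 ≤ (j : ℕ) := by exact_mod_cast hij
    unfold pcost
    linarith
end
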